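/- Let s, s̄ ∈ ℝ be distinct real numbers such that 0 ≠ r(s) − r(s̄) = ‖r(s) − r(s̄)‖·e₁ and r(s) ∉ {e₁, −e₁}. Then r is differentiable at s and at s̄; write r'(s) = x·e₁ + y·e₂ and r'(s̄) = x̄·e₁ + ȳ·e₂ with x, y, x̄, ȳ ∈ ℝ. For every sufficiently small ε ≠ 0 there is a unique small real number ε̄ = ε̄(ε) such that r(s̄ + ε̄) = \overline{r(s+ε)}, and the following hold: (1) y > 0 and ȳ < 0; (2) lim_{ε→0} ‖r(s̄+ε̄) − r(s̄)‖ / ‖r(s+ε) − r(s)‖ = −y/ȳ; (3) lim_{ε→0} (‖r(s+ε) − r(s̄+ε̄)‖ − ‖r(s) − r(s̄)‖)/ε = x − x̄·(y/ȳ); (4) lim_{ε→0⁺} (‖r(s+ε) − r(s̄)‖ − ‖r(s) − r(s̄)‖)/ε = x − j(0)·y/(1 + ĵ(0)); (5) lim_{ε→0⁻} (‖r(s+ε) − r(s̄)‖ − ‖r(s) − r(s̄)‖)/ε = x + j(0)·y/(1 − ĵ(0)). -/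

import Mathlib

open Metric Set Filter Topology

/-- A point `x` of the unit sphere of `X` is *smooth* if there is a unique continuous
linear functional `g : X →L[ℝ] ℝ` with `g x = 1 = ‖g‖`. -/
def IsSmoothPoint {X : Type*} [NormedAddCommGroup X] [NormedSpace ℝ X] (x : X) : Prop :=
  ∃! g : X →L[ℝ] ℝ, g x = 1 ∧ ‖g‖ = 1

/-- A real Banach space is *strictly convex* if every convex subset of its unit sphere
contains at most one point. -/
def StrictlyConvexSphere (X : Type*) [NormedAddCommGroup X] [NormedSpace ℝ X] : Prop :=
  ∀ s : Set X, s ⊆ sphere (0 : X) 1 → Convex ℝ s → s.Subsingleton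


lemma np_coords {X : Type*} [NormedAddCommGroup X] [NormedSpace ℝ X]
    (hdim : Module.finrank ℝ X = 2) (e₁ e₂ : X) (hInd : LinearIndependent ℝ ![e₁, e₂]) :
    ∃ φ₁ φ₂ : X →L[ℝ] ℝ, φ₁ e₁ = 1 ∧ φ₁ e₂ = 0 ∧ φ₂ e₁ = 0 ∧ φ₂ e₂ = 1 ∧
      ∀ w, w = φ₁ w • e₁ + φ₂ w • e₂ := by
  have hfd : FiniteDimensional ℝ X := Module.finite_of_finrank_pos (by omega)
  let b := basisOfLinearIndependentOfCardEqFinrank hInd (by simp [hdim])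
  have hb : ⇑b = ![e₁, e₂] := coe_basisOfLinearIndependentOfCardEqFinrank hInd _
  have h0 : b 0 = e₁ := by rw [hb]; rfl
  have h1 : b 1 = e₂ := by rw [hb]; rfl
  refine ⟨LinearMap.toContinuousLinearMap (b.coord 0), LinearMap.toContinuousLinearMap (b.coord 1),
    ?_, ?_, ?_, ?_, ?_⟩
  · rw [← h0]; simp
  · rw [← h1]; simp
  · rw [← h0]; simp
  · rw [← h1]; simp
  · intro w
    have := b.sum_repr w
    rw [Fin.sum_univ_two, h0, h1] at this
    simpa using this.symm

lemma np_norm_deriv {X : Type*} [NormedAddCommGroup X] [NormedSpace ℝ X]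
    {E : ℝ → X} {E' : X} {t : ℝ} (hE : HasDerivAt E E' t) (G : ℝ → (X →L[ℝ] ℝ))
    (hG1 : ∀ u, ‖G u‖ = 1) (hG2 : ∀ u, G u (E u) = ‖E u‖) (hGc : ContinuousAt G t) :
    HasDerivAt (fun u => ‖E u‖) (G t E') t := by
  have h1 : HasDerivAt (fun u => G t (E u)) (G t E') t := (G t).hasFDerivAt.comp_hasDerivAt t hE
  have h2 : (fun u => ‖E u‖ - ‖E t‖ - (G t (E u) - G t (E t))) =o[𝓝 t] fun u => u - t := by
    have h3 : (fun u => ‖E u‖ - ‖E t‖ - (G t (E u) - G t (E t))) =O[𝓝 t]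
        fun u => ‖G u - G t‖ * ‖E u - E t‖ := by
      refine Asymptotics.IsBigO.of_bound 1 (Eventually.of_forall fun u => ?_)
      have ha : G t (E u) ≤ ‖E u‖ := by
        have := (le_abs_self _).trans ((G t).le_opNorm (E u))
        rwa [hG1, one_mul] at this
      have hb : G u (E t) ≤ ‖E t‖ := by
        have := (le_abs_self _).trans ((G u).le_opNorm (E t))
        rwa [hG1, one_mul] at this
      have hc := (le_abs_self _).trans ((G u - G t).le_opNorm (E u - E t))
      simp only [sub_apply, map_sub, hG2] at hc
      rw [hG2, one_mul, Real.norm_of_nonneg (by linarith),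
        Real.norm_of_nonneg (by positivity)]
      linarith
    refine h3.trans_isLittleO ?_
    have h4 : (fun u => ‖G u - G t‖) =o[𝓝 t] fun _ => (1:ℝ) := by
      rw [Asymptotics.isLittleO_one_iff]
      have : Tendsto (fun u => G u - G t) (𝓝 t) (𝓝 0) := by
        simpa using hGc.tendsto.sub_const (G t)
      simpa using this.norm
    have h5 : (fun u => ‖E u - E t‖) =O[𝓝 t] fun u => u - t :=
      (hE.isBigO_sub).norm_left
    simpa using h4.mul_isBigO h5
  rw [hasDerivAt_iff_isLittleO] at h1 ⊢
  refine (h1.add h2).congr_left fun u => ?_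
  ring

lemma np_G_cont {X : Type*} [NormedAddCommGroup X] [NormedSpace ℝ X] [FiniteDimensional ℝ X]
    {E : ℝ → X} {t : ℝ} (hE : ContinuousAt E t) (hE0 : E t ≠ 0)
    (hsm : IsSmoothPoint (‖E t‖⁻¹ • E t)) (G : ℝ → (X →L[ℝ] ℝ))
    (hG1 : ∀ u, ‖G u‖ = 1) (hG2 : ∀ u, G u (E u) = ‖E u‖) : ContinuousAt G t := by
  have hprop : ProperSpace (X →L[ℝ] ℝ) := FiniteDimensional.proper ℝ _
  have hn : ‖E t‖ ≠ 0 := norm_ne_zero_iff.mpr hE0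
  refine IsCompact.tendsto_nhds_of_unique_mapClusterPt
    (isCompact_sphere (0 : X →L[ℝ] ℝ) 1) (Eventually.of_forall fun u => by simp [hG1]) ?_
  intro y hy hcl
  refine hsm.unique ⟨?_, by simpa using hy⟩ ⟨?_, hG1 t⟩
  · have hev : Continuous fun g : X →L[ℝ] ℝ => g (E t) := by fun_prop
    have hc := hcl.continuousAt_comp (f := fun g : X →L[ℝ] ℝ => g (E t)) hev.continuousAt
    have hlim : Tendsto ((fun g : X →L[ℝ] ℝ => g (E t)) ∘ G) (𝓝 t) (𝓝 ‖E t‖) := by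
      have h0 : Tendsto (fun u => ‖E u‖ - G u (E u - E t)) (𝓝 t) (𝓝 (‖E t‖ - 0)) := by
        refine hE.norm.tendsto.sub ?_
        have h1 : Tendsto (fun u => ‖E u - E t‖) (𝓝 t) (𝓝 0) := by
          have : Tendsto (fun u => E u - E t) (𝓝 t) (𝓝 0) := by
            simpa using hE.tendsto.sub_const (E t)
          simpa using this.norm
        refine squeeze_zero_norm (fun u => ?_) h1
        have := (G u).le_opNorm (E u - E t)
        rwa [hG1, one_mul] at this
      rw [sub_zero] at h0
      refine h0.congr fun u => ?_
      simp [hG2]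
    have : y (E t) = ‖E t‖ := by
      have h1 : ClusterPt (y (E t)) (𝓝 ‖E t‖) := ClusterPt.mono hc hlim
      exact eq_of_nhds_neBot h1
    rw [map_smul, this, smul_eq_mul, inv_mul_cancel₀ hn]
  · rw [map_smul, hG2, smul_eq_mul, inv_mul_cancel₀ hn]

lemma np_same_jet {X : Type*} [NormedAddCommGroup X] [NormedSpace ℝ X]
    {c₁ c₂ : ℝ → X} {v : X} {S : Set ℝ} {u D : ℝ} (h₁ : HasDerivWithinAt c₁ v S u)
    (h₂ : HasDerivWithinAt c₂ v S u) (h : c₁ u = c₂ u)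
    (hD : HasDerivWithinAt (fun t => ‖c₂ t‖) D S u) :
    HasDerivWithinAt (fun t => ‖c₁ t‖) D S u := by
  rw [hasDerivWithinAt_iff_isLittleO] at *
  have h3 := h₁.sub h₂
  have h4 : (fun t => ‖c₁ t‖ - ‖c₂ t‖) =o[𝓝[S] u] fun t => t - u := by
    refine Asymptotics.IsBigO.trans_isLittleO ?_ h3
    refine Asymptotics.IsBigO.of_bound 1 (Eventually.of_forall fun t => ?_)
    rw [one_mul]
    have := abs_norm_sub_norm_le (c₁ t) (c₂ t)
    rw [Real.norm_eq_abs]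
    refine this.trans (le_of_eq ?_)
    rw [h]; congr 1; abel
  refine (hD.add h4).congr_left fun t => ?_
  simp only [h]; ring

lemma np_curve {X : Type*} [NormedAddCommGroup X] [NormedSpace ℝ X] [FiniteDimensional ℝ X]
    (e₁ e₂ : X) (he₁ : e₁ ∈ sphere (0 : X) 1)
    (hns : ∀ x ∈ sphere (0 : X) 1, ¬ IsSmoothPoint x ↔ (x = e₁ ∨ x = -e₁))
    (φ₁ φ₂ : X →L[ℝ] ℝ) (h11 : φ₁ e₁ = 1) (h12 : φ₁ e₂ = 0) (h21 : φ₂ e₁ = 0) (h22 : φ₂ e₂ = 1)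
    (p : ℝ → X)
    (hp : ∀ t, p t = ‖Real.cos t • e₁ + Real.sin t • e₂‖⁻¹ •
      (Real.cos t • e₁ + Real.sin t • e₂)) :
    ∃ (G : ℝ → (X →L[ℝ] ℝ)) (P : ℝ → X) (m C : ℝ), 0 < m ∧ (∀ u, ‖G u‖ = 1) ∧
      (∀ u, G u (p u) = 1) ∧ ∀ u, Real.sin u ≠ 0 → HasDerivAt p (P u) u ∧ ContinuousAt P u ∧
        G u (P u) = 0 ∧ 0 < φ₁ (p u) * φ₂ (P u) - φ₂ (p u) * φ₁ (P u) ∧ m ≤ ‖P u‖ ∧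
        ‖P u‖ ≤ C := by
  have he1n : ‖e₁‖ = 1 := by simpa using he₁
  have hnt : Nontrivial X := ⟨⟨e₁, 0, by intro h; simp [h] at he1n⟩⟩
  set E : ℝ → X := fun t => Real.cos t • e₁ + Real.sin t • e₂ with hEdef
  set V : ℝ → X := fun t => -Real.sin t • e₁ + Real.cos t • e₂ with hVdef
  have hE : ∀ t, HasDerivAt E (V t) t := fun t =>
    ((Real.hasDerivAt_cos t).smul_const e₁).add ((Real.hasDerivAt_sin t).smul_const e₂)
  have hVc : Continuous V := by fun_prop
  have hEc : Continuous E := by fun_prop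
  have hφ1 : ∀ t, φ₁ (E t) = Real.cos t := by intro t; simp [hEdef, h11, h12]
  have hφ2 : ∀ t, φ₂ (E t) = Real.sin t := by intro t; simp [hEdef, h21, h22]
  have hψ1 : ∀ t, φ₁ (V t) = -Real.sin t := by intro t; simp [hVdef, h11, h12]
  have hψ2 : ∀ t, φ₂ (V t) = Real.cos t := by intro t; simp [hVdef, h21, h22]
  have hE0 : ∀ t, E t ≠ 0 := by
    intro t h
    have h1 := hφ1 t
    have h2 := hφ2 t
    rw [h, map_zero] at h1 h2
    have := Real.sin_sq_add_cos_sq t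
    rw [← h1, ← h2] at this; norm_num at this
  have hN : ∀ t, 0 < ‖E t‖ := fun t => norm_pos_iff.mpr (hE0 t)
  have hp' : ∀ t, p t = ‖E t‖⁻¹ • E t := hp
  have hpn : ∀ t, ‖p t‖ = 1 := by
    intro t
    rw [hp', norm_smul, norm_inv, norm_norm, inv_mul_cancel₀ (hN t).ne']
  have hsmooth : ∀ t, Real.sin t ≠ 0 → IsSmoothPoint (‖E t‖⁻¹ • E t) := by
    intro t ht
    by_contra hcon
    rw [← hp'] at hcon
    have h2 : φ₂ (p t) ≠ 0 := by
      rw [hp', map_smul, hφ2, smul_eq_mul]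
      exact mul_ne_zero (inv_ne_zero (hN t).ne') ht
    rcases (hns (p t) (by simp [hpn])).1 hcon with h | h
    · exact h2 (by rw [h, h21])
    · exact h2 (by rw [h, map_neg, h21, neg_zero])
  choose G hG1 hG2 using fun t => exists_dual_vector' ℝ (E t)
  replace hG2 : ∀ u, G u (E u) = ‖E u‖ := hG2
  have hGc : ∀ t, Real.sin t ≠ 0 → ContinuousAt G t := fun t ht =>
    np_G_cont hEc.continuousAt (hE0 t) (hsmooth t ht) G hG1 hG2
  set P : ℝ → X := fun u => ‖E u‖⁻¹ • V u - ((‖E u‖⁻¹) ^ 2 * G u (V u)) • E u with hPdef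
  set M := ‖e₁‖ + ‖e₂‖ with hM
  have hMpos : 0 < M := by rw [hM, he1n]; positivity
  have hEM : ∀ t, ‖E t‖ ≤ M := by
    intro t
    refine (norm_add_le _ _).trans (add_le_add ?_ ?_)
    · rw [norm_smul]
      exact mul_le_of_le_one_left (norm_nonneg _) (Real.abs_cos_le_one t)
    · rw [norm_smul]
      exact mul_le_of_le_one_left (norm_nonneg _) (Real.abs_sin_le_one t)
  have hVM : ∀ t, ‖V t‖ ≤ M := by
    intro t
    refine (norm_add_le _ _).trans (add_le_add ?_ ?_)
    · rw [norm_smul, norm_neg]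
      exact mul_le_of_le_one_left (norm_nonneg _) (Real.abs_sin_le_one t)
    · rw [norm_smul]
      exact mul_le_of_le_one_left (norm_nonneg _) (Real.abs_cos_le_one t)
  set K := ‖φ₁‖ + ‖φ₂‖ with hK
  have hinv : ∀ t, ‖E t‖⁻¹ ≤ K := by
    intro t
    rw [inv_le_iff_one_le_mul₀ (hN t)]
    have h1 := φ₁.le_opNorm (E t)
    have h2 := φ₂.le_opNorm (E t)
    rw [hφ1, Real.norm_eq_abs] at h1
    rw [hφ2, Real.norm_eq_abs] at h2
    have h3 : 1 ≤ |Real.cos t| + |Real.sin t| := by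
      have := Real.sin_sq_add_cos_sq t
      rw [← sq_abs (Real.sin t), ← sq_abs (Real.cos t)] at this
      nlinarith [abs_nonneg (Real.cos t), abs_nonneg (Real.sin t)]
    rw [hK, add_mul]; linarith
  have hGV : ∀ u, |G u (V u)| ≤ M := by
    intro u
    have := (G u).le_opNorm (V u)
    rw [hG1, one_mul] at this
    exact this.trans (hVM u)
  have hdet : ∀ u, φ₁ (p u) * φ₂ (P u) - φ₂ (p u) * φ₁ (P u) = (‖E u‖⁻¹) ^ 2 := by
    intro u
    simp only [hp', hPdef, map_sub, map_smul, hφ1, hφ2, hψ1, hψ2, smul_eq_mul]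
    linear_combination (‖E u‖⁻¹) ^ 2 * Real.sin_sq_add_cos_sq u
  refine ⟨G, P, (M⁻¹) ^ 2 / (2 * ‖φ₁‖ * ‖φ₂‖ + 1), K * M + K * M, by positivity, hG1, ?_, ?_⟩
  · intro u
    rw [hp', map_smul, hG2, smul_eq_mul, inv_mul_cancel₀ (hN u).ne']
  · intro u hu
    refine ⟨?_, ?_, ?_, ?_, ?_, ?_⟩
    · have h1 := np_norm_deriv (hE u) G hG1 hG2 (hGc u hu)
      have h2 := (h1.inv (hN u).ne').smul (hE u)
      have : p = (fun y => ‖E y‖)⁻¹ • E := by funext t; simp [hp']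
      rw [this]
      convert h2 using 1
      simp only [hPdef, Pi.inv_apply, sub_eq_add_neg, ← neg_smul]
      congr 2
      field_simp
    · have h1 := hGc u hu
      have h2 : ContinuousAt (fun t => G t (V t)) u := h1.clm_apply hVc.continuousAt
      have h3 : ContinuousAt (fun t => ‖E t‖⁻¹) u := hEc.norm.continuousAt.inv₀ (hN u).ne'
      exact (h3.smul hVc.continuousAt).sub (((h3.pow 2).mul h2).smul hEc.continuousAt)
    · simp only [hPdef, map_sub, map_smul, smul_eq_mul, hG2]
      have := (hN u).ne'
      field_simp
      ring
    · rw [hdet]; have := hN u; positivity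
    · rw [div_le_iff₀ (by positivity)]
      have h1 : (M⁻¹) ^ 2 ≤ (‖E u‖⁻¹) ^ 2 := by
        have := hN u
        have := hEM u
        gcongr
      have a1 : |φ₁ (p u)| ≤ ‖φ₁‖ := by
        have := φ₁.le_opNorm (p u); rwa [hpn, mul_one] at this
      have a2 : |φ₂ (p u)| ≤ ‖φ₂‖ := by
        have := φ₂.le_opNorm (p u); rwa [hpn, mul_one] at this
      have b1 : |φ₁ (P u)| ≤ ‖φ₁‖ * ‖P u‖ := φ₁.le_opNorm (P u)
      have b2 : |φ₂ (P u)| ≤ ‖φ₂‖ * ‖P u‖ := φ₂.le_opNorm (P u)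
      have c1 : φ₁ (p u) * φ₂ (P u) ≤ ‖φ₁‖ * (‖φ₂‖ * ‖P u‖) := by
        refine (le_abs_self _).trans ?_
        rw [abs_mul]; gcongr
      have c2 : -(φ₂ (p u) * φ₁ (P u)) ≤ ‖φ₂‖ * (‖φ₁‖ * ‖P u‖) := by
        refine (neg_le_abs _).trans ?_
        rw [abs_mul]; gcongr
      have := hdet u
      have := norm_nonneg (P u)
      nlinarith
    · refine (norm_sub_le _ _).trans (add_le_add ?_ ?_)
      · rw [norm_smul, norm_inv, norm_norm]
        exact mul_le_mul (hinv u) (hVM u) (norm_nonneg _) (by positivity)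
      · rw [norm_smul, norm_mul, norm_pow, norm_inv, norm_norm, Real.norm_eq_abs]
        have : ‖E u‖⁻¹ ^ 2 * |G u (V u)| * ‖E u‖ = ‖E u‖⁻¹ * |G u (V u)| := by
          have := (hN u).ne'
          field_simp
        rw [this]
        exact mul_le_mul (hinv u) (hGV u) (abs_nonneg _) (by positivity)

lemma np_sigma {X : Type*} [NormedAddCommGroup X] [NormedSpace ℝ X] [CompleteSpace X]
    (p P : ℝ → X) (m C : ℝ)
    (hpπ : ∀ t, p (t + Real.pi) = - p t)
    (hP : ∀ u, Real.sin u ≠ 0 → HasDerivAt p (P u) u ∧ ContinuousAt P u ∧ m ≤ ‖P u‖ ∧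
        ‖P u‖ ≤ C)
    (σ : ℝ → ℝ) (hσ : ∀ t, σ t = ∫ u in (0:ℝ)..t, ‖derivWithin p (Ici u) u‖) :
    (∀ a b, a ≤ b → m * (b - a) ≤ σ b - σ a ∧ σ b - σ a ≤ C * (b - a)) ∧
    (∀ u, Real.sin u ≠ 0 → HasDerivAt σ ‖P u‖ u) ∧
    (∃ η, ∀ t, σ (t + Real.pi) = σ t + η) := by
  set f : ℝ → ℝ := fun u => ‖derivWithin p (Ici u) u‖ with hf
  have hfP : ∀ u, Real.sin u ≠ 0 → f u = ‖P u‖ := by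
    intro u hu
    simp only [hf]
    rw [(hP u hu).1.hasDerivWithinAt.derivWithin (uniqueDiffOn_Ici u u (mem_Ici.mpr le_rfl))]
  have hmeas : Measurable f := by
    borelize X
    exact (measurable_derivWithin_Ici p).norm
  have hae : ∀ᵐ u ∂(MeasureTheory.volume : MeasureTheory.Measure ℝ), Real.sin u ≠ 0 := by
    have hcount : ({u : ℝ | Real.sin u = 0}).Countable := by
      have : {u : ℝ | Real.sin u = 0} = range (fun n : ℤ => (n : ℝ) * Real.pi) := by
        ext u; simp [Real.sin_eq_zero_iff]
      rw [this]; exact countable_range _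
    have := hcount.ae_notMem (MeasureTheory.volume : MeasureTheory.Measure ℝ)
    filter_upwards [this] with u hu using hu
  have hup : ∀ᵐ u ∂(MeasureTheory.volume : MeasureTheory.Measure ℝ), f u ≤ C := by
    filter_upwards [hae] with u hu
    rw [hfP u hu]; exact (hP u hu).2.2.2
  have hlo : ∀ᵐ u ∂(MeasureTheory.volume : MeasureTheory.Measure ℝ), m ≤ f u := by
    filter_upwards [hae] with u hu
    rw [hfP u hu]; exact (hP u hu).2.2.1
  have hint : ∀ a b, IntervalIntegrable f MeasureTheory.volume a b := by
    intro a b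
    refine (intervalIntegrable_const (c := C)).mono_fun hmeas.aestronglyMeasurable ?_
    refine MeasureTheory.ae_restrict_of_ae ?_
    filter_upwards [hup] with u hu
    have h0 : 0 ≤ f u := norm_nonneg _
    rw [Real.norm_of_nonneg h0, Real.norm_of_nonneg (h0.trans hu)]
    exact hu
  have hσ' : ∀ t, σ t = ∫ u in (0:ℝ)..t, f u := hσ
  have hdiff : ∀ a b, σ b - σ a = ∫ u in a..b, f u := by
    intro a b
    rw [hσ', hσ', intervalIntegral.integral_interval_sub_left (hint _ _) (hint _ _)]
  refine ⟨?_, ?_, ?_⟩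
  · intro a b hab
    rw [hdiff]
    constructor
    · have := intervalIntegral.integral_mono_ae hab (intervalIntegrable_const (c := m)) (hint a b) hlo
      simpa [mul_comm] using this
    · have := intervalIntegral.integral_mono_ae hab (hint a b) (intervalIntegrable_const (c := C)) hup
      simpa [mul_comm] using this
  · intro u hu
    have hev : ∀ᶠ v in 𝓝 u, Real.sin v ≠ 0 :=
      Real.continuous_sin.continuousAt.eventually_ne hu
    have hc : ContinuousAt f u := by
      refine ((hP u hu).2.1.norm).congr ?_
      filter_upwards [hev] with v hv using (hfP v hv).symm
    have := intervalIntegral.integral_hasDerivAt_right (hint 0 u)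
      hmeas.stronglyMeasurable.stronglyMeasurableAtFilter hc
    rw [hfP u hu] at this
    have hs : σ = fun t => ∫ u in (0:ℝ)..t, f u := funext hσ'
    rw [hs]; exact this
  · have hper : Function.Periodic f Real.pi := by
      intro u
      simp only [hf]
      have h1 : derivWithin p (Ici (u + Real.pi)) (u + Real.pi)
          = derivWithin (fun t => p (t + Real.pi)) (Ici u) u := by
        have := derivWithin_comp_add_const (f := p) (s := Ici u) Real.pi u
        rw [this]
        congr 1
        ext x
        rw [Set.mem_vadd_set_iff_neg_vadd_mem]
        simp only [mem_Ici, vadd_eq_add]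
        constructor <;> intro h <;> linarith
      rw [h1]
      have h2 : (fun t => p (t + Real.pi)) = fun t => - p t := funext hpπ
      rw [h2, derivWithin.fun_neg, norm_neg]
    refine ⟨∫ u in (0:ℝ)..(0 + Real.pi), f u, fun t => ?_⟩
    have := hdiff t (t + Real.pi)
    rw [hper.intervalIntegral_add_eq t 0] at this
    linarith

lemma np_sign {X : Type*} [NormedAddCommGroup X] [NormedSpace ℝ X]
    (hsc : StrictlyConvexSphere X) (e u w : X) (d : ℝ) (hd : 0 < d) (hu : ‖u‖ = 1) (hw : ‖w‖ = 1)
    (he : ‖e‖ = 1) (h : u - w = d • e) (g : X →L[ℝ] ℝ) (hg : ‖g‖ = 1) (hgu : g u = 1) :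
    0 < g e := by
  have hle : ∀ z, g z ≤ ‖z‖ := by
    intro z
    have := (le_abs_self _).trans (g.le_opNorm z)
    rwa [hg, one_mul] at this
  have h1 : g u - g w = d * g e := by rw [← map_sub, h, map_smul, smul_eq_mul]
  have h2 := hle w
  rw [hw] at h2
  have h3 : 0 ≤ g e := by
    by_contra hc
    push Not at hc
    nlinarith
  rcases h3.lt_or_eq with h4 | h4
  · exact h4
  exfalso
  have hgw : g w = 1 := by rw [← h4] at h1; linarith
  have hsub : segment ℝ u w ⊆ sphere (0 : X) 1 := by
    intro z hz
    have hz1 : ‖z‖ ≤ 1 := by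
      have := (convex_closedBall (0 : X) 1).segment_subset (x := u) (y := w) (by simp [hu])
        (by simp [hw]) hz
      simpa using this
    obtain ⟨a, b, ha, hb, hab, rfl⟩ := hz
    have := hle (a • u + b • w)
    rw [map_add, map_smul, map_smul, hgu, hgw, smul_eq_mul, smul_eq_mul, mul_one, mul_one, hab] at this
    simp only [mem_sphere_zero_iff_norm]
    exact le_antisymm hz1 this
  have := hsc _ hsub (convex_segment u w) (left_mem_segment ℝ u w) (right_mem_segment ℝ u w)
  rw [this, sub_self] at h
  have := smul_eq_zero.mp h.symm
  rcases this with h | h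
  · exact hd.ne' h
  · rw [h, norm_zero] at he; norm_num at he

lemma np_oneside {X : Type*} [NormedAddCommGroup X] [NormedSpace ℝ X]
    (r : ℝ → X) (e₁ dq ds : X) (S : Set ℝ) (h0S : (0:ℝ) ∈ S)
    (hS : ∀ k : ℝ, 0 < k → ∀ t ∈ S, k * t ∈ S)
    (hr0 : r 0 = e₁) (hrn : ∀ t, ‖r t‖ = 1)
    (hdq : HasDerivWithinAt r dq S 0) (s sb d α β : ℝ) (hd : 0 < d) (hβ : 0 < β)
    (hds : HasDerivAt r ds s) (hdecomp : ds = α • e₁ + β • dq) (h : r s - r sb = d • e₁) :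
    Tendsto (fun ε : ℝ => (‖r (s + ε) - r sb‖ - ‖r s - r sb‖) / ε) (𝓝[S \ {0}] 0) (𝓝 α) := by
  have hc1 : HasDerivWithinAt (fun ε => r (s + ε) - r sb) ds S 0 := by
    have h1 : HasDerivAt (fun ε => r (s + ε)) ds 0 := by
      have := HasDerivAt.comp_const_add (f := r) (f' := ds) s 0 (by simpa using hds)
      exact this
    exact (h1.sub_const _).hasDerivWithinAt
  have hc2 : HasDerivWithinAt (fun ε => (d + α * ε) • r (β / d * ε)) ds S 0 := by
    have hin : HasDerivWithinAt (fun ε : ℝ => β / d * ε) (β / d) S 0 := by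
      simpa using ((hasDerivAt_id (0:ℝ)).const_mul (β / d)).hasDerivWithinAt
    have h1 : HasDerivWithinAt (fun ε => r (β / d * ε)) ((β / d) • dq) S 0 := by
      refine HasDerivWithinAt.scomp (t' := S) (0:ℝ) (by simpa using hdq) hin ?_
      intro t ht
      exact hS _ (by positivity) t ht
    have h2 : HasDerivWithinAt (fun ε : ℝ => d + α * ε) α S 0 := by
      simpa using (((hasDerivAt_id (0:ℝ)).const_mul α).const_add d).hasDerivWithinAt
    have h3 := h2.smul h1
    refine HasDerivWithinAt.congr_deriv h3 ?_
    rw [hdecomp]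
    simp only [mul_zero, add_zero, hr0, smul_smul]
    rw [mul_div_cancel₀ _ hd.ne', add_comm]
  have hD : HasDerivWithinAt (fun ε => ‖(d + α * ε) • r (β / d * ε)‖) α S 0 := by
    have h2 : HasDerivAt (fun ε : ℝ => d + α * ε) α 0 := by
      simpa using (((hasDerivAt_id (0:ℝ)).const_mul α).const_add d)
    refine (h2.congr_of_eventuallyEq ?_).hasDerivWithinAt
    have hc : Tendsto (fun ε : ℝ => d + α * ε) (𝓝 0) (𝓝 d) := by
      have : Continuous (fun ε : ℝ => d + α * ε) := by fun_prop
      simpa using this.tendsto 0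
    filter_upwards [hc.eventually (lt_mem_nhds hd)] with ε hε
    rw [norm_smul, hrn, mul_one, Real.norm_of_nonneg hε.le]
  have h4 := np_same_jet hc1 hc2 (by simp [h, hr0]) hD
  rw [hasDerivWithinAt_iff_tendsto_slope] at h4
  refine h4.congr fun ε => ?_
  simp [slope_def_field]

lemma np_rates {X : Type*} [NormedAddCommGroup X] [NormedSpace ℝ X]
    (r : ℝ → X) (e₁ : X) (he₁ : ‖e₁‖ = 1) (φ₁ φ₂ : X →L[ℝ] ℝ) (h11 : φ₁ e₁ = 1) (h21 : φ₂ e₁ = 0)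
    (ds dsb : X) (s sb d : ℝ) (hd : 0 < d) (hds : HasDerivAt r ds s) (hdsb : HasDerivAt r dsb sb)
    (hn : ‖ds‖ = 1) (hnb : ‖dsb‖ = 1)
    (hy : 0 < φ₂ ds) (hyb : φ₂ dsb < 0) (h : r s - r sb = d • e₁) (eb : ℝ → ℝ)
    (heb : Tendsto eb (𝓝[≠] (0:ℝ)) (𝓝 0))
    (hev : ∀ᶠ ε in 𝓝[≠] (0:ℝ), ∃ t : ℝ, r (s + ε) - r (sb + eb ε) = t • e₁) :
    Tendsto (fun ε : ℝ => ‖r (sb + eb ε) - r sb‖ / ‖r (s + ε) - r s‖)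
      (𝓝[≠] 0) (𝓝 (-(φ₂ ds / φ₂ dsb))) ∧
    Tendsto (fun ε : ℝ => (‖r (s + ε) - r (sb + eb ε)‖ - ‖r s - r sb‖) / ε)
      (𝓝[≠] 0) (𝓝 (φ₁ ds - φ₁ dsb * (φ₂ ds / φ₂ dsb))) := by
  set Q : ℝ → X := fun ε => dslope r s (s + ε) with hQ
  set R : ℝ → X := fun ε => dslope r sb (sb + eb ε) with hR
  have hQe : ∀ ε, r (s + ε) = r s + ε • Q ε := by
    intro ε
    have := sub_smul_dslope r s (s + ε)
    rw [add_sub_cancel_left] at this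
    simp only [hQ, this]; abel
  have hRe : ∀ ε, r (sb + eb ε) = r sb + eb ε • R ε := by
    intro ε
    have := sub_smul_dslope r sb (sb + eb ε)
    rw [add_sub_cancel_left] at this
    simp only [hR, this]; abel
  have hid : Tendsto (fun ε : ℝ => ε) (𝓝[≠] (0:ℝ)) (𝓝 0) := tendsto_id.mono_left nhdsWithin_le_nhds
  have hQl : Tendsto Q (𝓝[≠] 0) (𝓝 ds) := by
    have h1 := (continuousAt_dslope_same.mpr hds.differentiableAt).tendsto
    rw [dslope_same, hds.deriv] at h1
    refine h1.comp ?_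
    simpa using hid.const_add s
  have hRl : Tendsto R (𝓝[≠] 0) (𝓝 dsb) := by
    have h1 := (continuousAt_dslope_same.mpr hdsb.differentiableAt).tendsto
    rw [dslope_same, hdsb.deriv] at h1
    refine h1.comp ?_
    simpa using heb.const_add sb
  have hne : ∀ᶠ ε in 𝓝[≠] (0:ℝ), ε ≠ 0 := eventually_mem_nhdsWithin
  have hφ2Q : Tendsto (fun ε => φ₂ (Q ε)) (𝓝[≠] 0) (𝓝 (φ₂ ds)) := (φ₂.continuous.tendsto _).comp hQl
  have hφ2R : Tendsto (fun ε => φ₂ (R ε)) (𝓝[≠] 0) (𝓝 (φ₂ dsb)) :=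
    (φ₂.continuous.tendsto _).comp hRl
  have hφ1Q : Tendsto (fun ε => φ₁ (Q ε)) (𝓝[≠] 0) (𝓝 (φ₁ ds)) := (φ₁.continuous.tendsto _).comp hQl
  have hφ1R : Tendsto (fun ε => φ₁ (R ε)) (𝓝[≠] 0) (𝓝 (φ₁ dsb)) :=
    (φ₁.continuous.tendsto _).comp hRl
  have hratio : Tendsto (fun ε => eb ε / ε) (𝓝[≠] 0) (𝓝 (φ₂ ds / φ₂ dsb)) := by
    refine (hφ2Q.div hφ2R hyb.ne).congr' ?_
    filter_upwards [hev, hne, hφ2R.eventually (gt_mem_nhds hyb)] with ε ⟨t, ht⟩ hε hneg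
    have h1 := congrArg φ₂ ht
    have h2 := congrArg φ₂ h
    rw [hQe, hRe] at h1
    simp only [map_sub, map_add, map_smul, smul_eq_mul, h21, mul_zero] at h1 h2
    simp only [Pi.div_apply]
    rw [div_eq_div_iff hneg.ne hε]
    linarith
  constructor
  · have h1 := (hratio.norm.mul hRl.norm).div hQl.norm (by rw [hn]; norm_num)
    have h2 : ‖φ₂ ds / φ₂ dsb‖ * ‖dsb‖ / ‖ds‖ = -(φ₂ ds / φ₂ dsb) := by
      rw [hn, hnb, Real.norm_of_nonpos (div_nonpos_of_nonneg_of_nonpos hy.le hyb.le)]; ring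
    rw [h2] at h1
    refine h1.congr' ?_
    filter_upwards [hne] with ε hε
    simp only [Pi.div_apply]
    rw [hQe, hRe, add_sub_cancel_left, add_sub_cancel_left, norm_smul, norm_smul, norm_div]
    rw [div_mul_eq_mul_div, div_div]
  · have h1 : Tendsto (fun ε => φ₁ (Q ε) - φ₁ (R ε) * (eb ε / ε)) (𝓝[≠] 0)
        (𝓝 (φ₁ ds - φ₁ dsb * (φ₂ ds / φ₂ dsb))) := hφ1Q.sub (hφ1R.mul hratio)
    have h2 : Tendsto (fun ε => d + ε * φ₁ (Q ε) - eb ε * φ₁ (R ε)) (𝓝[≠] 0) (𝓝 d) := by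
      simpa using ((hid.mul hφ1Q).const_add d).sub (heb.mul hφ1R)
    refine h1.congr' ?_
    filter_upwards [hev, hne, h2.eventually (lt_mem_nhds hd)] with ε ⟨t, ht⟩ hε hpos
    have h3 := congrArg φ₁ ht
    have h4 := congrArg φ₁ h
    rw [hQe, hRe] at h3
    simp only [map_sub, map_add, map_smul, smul_eq_mul, h11, mul_one] at h3 h4
    have h5 : t = d + ε * φ₁ (Q ε) - eb ε * φ₁ (R ε) := by linarith
    rw [ht, h, norm_smul, norm_smul, he₁, mul_one, mul_one, Real.norm_of_nonneg hd.le,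
      Real.norm_of_nonneg (by rw [h5]; exact hpos.le), h5]
    field_simp
    ring

lemma np_angle {X : Type*} [NormedAddCommGroup X] [NormedSpace ℝ X]
    (e₁ e₂ : X) (φ₁ φ₂ : X →L[ℝ] ℝ) (h11 : φ₁ e₁ = 1) (h12 : φ₁ e₂ = 0) (h21 : φ₂ e₁ = 0)
    (h22 : φ₂ e₂ = 1) (hw : ∀ w, w = φ₁ w • e₁ + φ₂ w • e₂)
    (p : ℝ → X)
    (hp : ∀ t, p t = ‖Real.cos t • e₁ + Real.sin t • e₂‖⁻¹ •
      (Real.cos t • e₁ + Real.sin t • e₂)) :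
    (∀ t, 0 < ‖Real.cos t • e₁ + Real.sin t • e₂‖) ∧ (∀ t, ‖p t‖ = 1) ∧
    (∀ t u, p t = p u → |t - u| < 2 * Real.pi → t = u) ∧
    (∀ w, ‖w‖ = 1 → ∀ a, ∃ t ∈ Ioc a (a + 2 * Real.pi), p t = w) := by
  have hN : ∀ t, 0 < ‖Real.cos t • e₁ + Real.sin t • e₂‖ := by
    intro t
    refine norm_pos_iff.mpr fun h => ?_
    have h1 := congrArg φ₁ h
    have h2 := congrArg φ₂ h
    simp only [map_add, map_smul, smul_eq_mul, h11, h12, h21, h22, map_zero, mul_one, mul_zero,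
      add_zero, zero_add] at h1 h2
    have := Real.sin_sq_add_cos_sq t
    rw [h1, h2] at this; norm_num at this
  refine ⟨hN, ?_, ?_, ?_⟩
  · intro t
    rw [hp, norm_smul, norm_inv, norm_norm, inv_mul_cancel₀ (hN t).ne']
  · intro t u h hlt
    have h1 := congrArg φ₁ h
    have h2 := congrArg φ₂ h
    rw [hp, hp] at h1 h2
    simp only [map_add, map_smul, smul_eq_mul, h11, h12, h21, h22, mul_one, mul_zero,
      add_zero, zero_add] at h1 h2
    set A := ‖Real.cos t • e₁ + Real.sin t • e₂‖⁻¹ with hA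
    set B := ‖Real.cos u • e₁ + Real.sin u • e₂‖⁻¹ with hB
    have hApos : 0 < A := inv_pos.mpr (hN t)
    have hBpos : 0 < B := inv_pos.mpr (hN u)
    have hsq : A ^ 2 = B ^ 2 := by
      have a := Real.sin_sq_add_cos_sq t
      have b := Real.sin_sq_add_cos_sq u
      calc A ^ 2 = (A * Real.cos t) ^ 2 + (A * Real.sin t) ^ 2 := by
            linear_combination -A ^ 2 * a
        _ = (B * Real.cos u) ^ 2 + (B * Real.sin u) ^ 2 := by rw [h1, h2]
        _ = B ^ 2 := by linear_combination B ^ 2 * b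
    have hAB : A = B := by
      rwa [sq_eq_sq₀ hApos.le hBpos.le] at hsq
    rw [hAB] at h1 h2
    have hc := mul_left_cancel₀ hBpos.ne' h1
    have hs := mul_left_cancel₀ hBpos.ne' h2
    have hcos : Real.cos (t - u) = 1 := by
      rw [Real.cos_sub, hc, hs]
      linear_combination Real.sin_sq_add_cos_sq u
    rw [abs_lt] at hlt
    have := (Real.cos_eq_one_iff_of_lt_of_lt hlt.1 hlt.2).1 hcos
    linarith
  · intro w hwn a
    have hper : Function.Periodic p (2 * Real.pi) := by
      intro t
      rw [hp, hp, Real.cos_add_two_pi, Real.sin_add_two_pi]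
    set z : ℂ := ⟨φ₁ w, φ₂ w⟩ with hz
    have hc : ‖z‖ * Real.cos z.arg = φ₁ w := Complex.norm_mul_cos_arg z
    have hs : ‖z‖ * Real.sin z.arg = φ₂ w := Complex.norm_mul_sin_arg z
    have hwE : w = ‖z‖ • (Real.cos z.arg • e₁ + Real.sin z.arg • e₂) := by
      rw [smul_add, smul_smul, smul_smul, hc, hs]; exact hw w
    have hpw : p z.arg = w := by
      have h1 := congrArg norm hwE
      rw [hwn, norm_smul, norm_norm] at h1
      rw [hp]
      conv_rhs => rw [hwE]
      congr 1
      exact inv_eq_of_mul_eq_one_left h1.symm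
    have h2π : (0:ℝ) < 2 * Real.pi := by positivity
    refine ⟨toIocMod h2π a z.arg, toIocMod_mem_Ioc h2π a z.arg, ?_⟩
    rw [← hpw, toIocMod]
    exact hper.sub_zsmul_eq _

lemma np_side_pos {X : Type*} [NormedAddCommGroup X] [NormedSpace ℝ X]
    (r : ℝ → X) (φ₂ : X →L[ℝ] ℝ) (dq : X) (S : Set ℝ) [(𝓝[S \ {0}] (0:ℝ)).NeBot]
    (hdq : HasDerivWithinAt r dq S 0) (h0 : φ₂ (r 0) = 0) (c : ℝ)
    (hc : ∀ᶠ h in 𝓝[≠] (0:ℝ), c ≤ φ₂ (r h) / h) : c ≤ φ₂ dq := by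
  have h1 : HasDerivWithinAt (fun t => φ₂ (r t)) (φ₂ dq) S 0 :=
    φ₂.hasFDerivAt.comp_hasDerivWithinAt (0:ℝ) hdq
  rw [hasDerivWithinAt_iff_tendsto_slope] at h1
  refine ge_of_tendsto h1 ?_
  have hle : 𝓝[S \ {0}] (0:ℝ) ≤ 𝓝[≠] 0 := nhdsWithin_mono _ fun x hx => hx.2
  filter_upwards [hle hc] with t ht
  simpa [slope_def_field, h0] using ht

/-- Let `X` be a strictly convex 2-dimensional real Banach space whose unit sphere has
exactly two non-smooth points `e₁`, `-e₁`, let `r` be the natural parameterization with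
`e₂ = r'±(0)`, and let `bar x` denote the unique point with `{x, bar x} = S_X ∩ (x + ℝ·e₁)`.
Let `s ≠ sb` satisfy `0 ≠ r s - r sb = ‖r s - r sb‖ • e₁` and `r s ∉ {e₁, -e₁}`.  Then `r`
is differentiable at `s` and `sb`; writing `r' s = x • e₁ + y • e₂` and
`r' sb = xb • e₁ + yb • e₂`, and letting `ε̄ = eb ε` be the unique small number with
`r (sb + eb ε) = bar (r (s + ε))`, we have: (1) `y > 0 > yb`;
(2) `‖r (sb + eb ε) - r sb‖ / ‖r (s+ε) - r s‖ → -y/yb`;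
(3) `(‖r (s+ε) - r (sb + eb ε)‖ - ‖r s - r sb‖)/ε → x - xb·(y/yb)`;
(4) `(‖r (s+ε) - r sb‖ - ‖r s - r sb‖)/ε → x - j(0)·y/(1 + ĵ(0))` as `ε → 0⁺`;
(5) `(‖r (s+ε) - r sb‖ - ‖r s - r sb‖)/ε → x + j(0)·y/(1 - ĵ(0))` as `ε → 0⁻`. -/
theorem natural_parameterization_opposite_points
    {X : Type*} [NormedAddCommGroup X] [NormedSpace ℝ X] [CompleteSpace X]
    (hdim : Module.finrank ℝ X = 2)
    (hsc : StrictlyConvexSphere X)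
    (e₁ e₂ : X) (hInd : LinearIndependent ℝ ![e₁, e₂])
    (he₁ : e₁ ∈ sphere (0 : X) 1)
    -- `e₁` and `-e₁` are the only non-smooth points of the sphere
    (hns : ∀ x ∈ sphere (0 : X) 1, ¬ IsSmoothPoint x ↔ (x = e₁ ∨ x = -e₁))
    (p : ℝ → X)
    (hp : ∀ t, p t = ‖Real.cos t • e₁ + Real.sin t • e₂‖⁻¹ •
      (Real.cos t • e₁ + Real.sin t • e₂))
    (σ : ℝ → ℝ) (hσ : ∀ t, σ t = ∫ u in (0:ℝ)..t, ‖derivWithin p (Ici u) u‖)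
    (τ : ℝ → ℝ) (hτ_cont : Continuous τ) (hτ_mono : StrictMono τ)
    (hστ : ∀ x, σ (τ x) = x)
    (r : ℝ → X) (hr : ∀ s, r s = p (τ s))
    -- the one-sided derivatives of `r` at `0`, with `e₂ = r'±(0)`
    (dm dp : X)
    (hdm : HasDerivWithinAt r dm (Iic (0:ℝ)) 0) (hdp : HasDerivWithinAt r dp (Ici (0:ℝ)) 0)
    (he₂ : e₂ = (1/2 : ℝ) • (dp + dm))
    -- the radial jump `j` and tangential jump `ĵ` at `0`
    (j jhat : ℝ)
    (hjj : (1/2 : ℝ) • (dp - dm) = j • r 0 + jhat • ((1/2 : ℝ) • (dp + dm)))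
    -- `bar x` is the unique point of the sphere with `{x, bar x} = S_X ∩ (x + ℝ·e₁)`
    (bar : X → X)
    (hbar : ∀ x ∈ sphere (0 : X) 1,
      ({x, bar x} : Set X) = sphere (0 : X) 1 ∩ {w : X | ∃ t : ℝ, w = x + t • e₁})
    -- the two opposite parameters
    (s sb : ℝ) (hssb : s ≠ sb)
    (hne : r s - r sb ≠ 0) (heq : r s - r sb = ‖r s - r sb‖ • e₁)
    (hs₁ : r s ≠ e₁) (hs₂ : r s ≠ -e₁) :
    ∃ ds dsb : X, HasDerivAt r ds s ∧ HasDerivAt r dsb sb ∧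
      -- for every small `ε ≠ 0` there is a unique small `ε̄` with `r (sb+ε̄) = bar (r (s+ε))`
      (∃ η > (0:ℝ), ∀ ε : ℝ, ε ≠ 0 → |ε| < η →
        ∃! εb : ℝ, |εb| < η ∧ r (sb + εb) = bar (r (s + ε))) ∧
      ∀ x y xb yb : ℝ, ds = x • e₁ + y • e₂ → dsb = xb • e₁ + yb • e₂ →
        (0 < y ∧ yb < 0) ∧
        (∀ eb : ℝ → ℝ, Tendsto eb (𝓝[≠] (0:ℝ)) (𝓝 0) →
          (∀ᶠ ε in 𝓝[≠] (0:ℝ), r (sb + eb ε) = bar (r (s + ε))) →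
          Tendsto (fun ε : ℝ => ‖r (sb + eb ε) - r sb‖ / ‖r (s + ε) - r s‖)
            (𝓝[≠] 0) (𝓝 (-(y / yb))) ∧
          Tendsto (fun ε : ℝ => (‖r (s + ε) - r (sb + eb ε)‖ - ‖r s - r sb‖) / ε)
            (𝓝[≠] 0) (𝓝 (x - xb * (y / yb)))) ∧
        Tendsto (fun ε : ℝ => (‖r (s + ε) - r sb‖ - ‖r s - r sb‖) / ε)
          (𝓝[>] 0) (𝓝 (x - j * y / (1 + jhat))) ∧
        Tendsto (fun ε : ℝ => (‖r (s + ε) - r sb‖ - ‖r s - r sb‖) / ε)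
          (𝓝[<] 0) (𝓝 (x + j * y / (1 - jhat))) := by
  obtain ⟨φ₁, φ₂, h11, h12, h21, h22, hw⟩ := np_coords hdim e₁ e₂ hInd
  have hfd : FiniteDimensional ℝ X := Module.finite_of_finrank_pos (by omega)
  have he1n : ‖e₁‖ = 1 := by simpa using he₁
  obtain ⟨hN, hpn, hinj, hsurj⟩ := np_angle e₁ e₂ φ₁ φ₂ h11 h12 h21 h22 hw p hp
  obtain ⟨G, P, m, C, hm, hG1, hGp, hP⟩ := np_curve e₁ e₂ he₁ hns φ₁ φ₂ h11 h12 h21 h22 p hp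
  have hpπ : ∀ t, p (t + Real.pi) = - p t := by
    intro t
    rw [hp, hp, Real.cos_add_pi, Real.sin_add_pi]
    have : -Real.cos t • e₁ + -Real.sin t • e₂ = -(Real.cos t • e₁ + Real.sin t • e₂) := by
      rw [neg_smul, neg_smul]; abel
    rw [this, norm_neg, smul_neg]
  obtain ⟨hσb, hσd, η, hη⟩ := np_sigma p P m C hpπ
    (fun u hu => ⟨(hP u hu).1, (hP u hu).2.1, (hP u hu).2.2.2.2⟩) σ hσ
  have hσmono : StrictMono σ := by
    intro a b hab
    have := (hσb a b hab.le).1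
    nlinarith [mul_pos hm (sub_pos.mpr hab)]
  have hτσ : ∀ t, τ (σ t) = t := fun t => hσmono.injective (hστ _)
  have hσ0 : σ 0 = 0 := by rw [hσ]; simp
  have hτ0 : τ 0 = 0 := by have := hτσ 0; rwa [hσ0] at this
  have hC : 0 < C := by
    have := hσb 0 1 zero_le_one
    linarith [this.1, this.2]
  have hr0 : r 0 = e₁ := by rw [hr, hτ0, hp]; simp [he1n]
  have hrn : ∀ t, ‖r t‖ = 1 := fun t => by rw [hr, hpn]
  have hφ2r : ∀ t, φ₂ (r t) = ‖Real.cos (τ t) • e₁ + Real.sin (τ t) • e₂‖⁻¹ * Real.sin (τ t) := by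
    intro t
    rw [hr, hp, map_smul, map_add, map_smul, map_smul, h21, h22]; simp
  set d := ‖r s - r sb‖ with hd_def
  have hd : 0 < d := norm_pos_iff.mpr hne
  -- second coordinates do not vanish
  have hb : φ₂ (r s) ≠ 0 := by
    intro h
    have h1 := hw (r s)
    rw [h, zero_smul, add_zero] at h1
    have h2 := hrn s
    rw [h1, norm_smul, he1n, mul_one, Real.norm_eq_abs] at h2
    rcases (abs_eq (zero_le_one)).1 h2 with h3 | h3
    · exact hs₁ (by rw [h1, h3, one_smul])
    · exact hs₂ (by rw [h1, h3, neg_smul, one_smul])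
  have hbb : φ₂ (r sb) ≠ 0 := by
    have := congrArg φ₂ heq
    rw [map_sub, map_smul, h21, smul_zero] at this
    rwa [← sub_eq_zero.mp this]
  have hsin : ∀ t, φ₂ (r t) ≠ 0 → Real.sin (τ t) ≠ 0 := by
    intro t ht h
    rw [hφ2r, h, mul_zero] at ht
    exact ht rfl
  have hrfun : r = p ∘ τ := funext hr
  have hrd : ∀ t, φ₂ (r t) ≠ 0 → HasDerivAt r (‖P (τ t)‖⁻¹ • P (τ t)) t := by
    intro t ht
    have hu := hsin t ht
    have hPpos : 0 < ‖P (τ t)‖ := hm.trans_le (hP _ hu).2.2.2.2.1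
    have h1 : HasDerivAt τ (‖P (τ t)‖⁻¹) t :=
      HasDerivAt.of_local_left_inverse hτ_cont.continuousAt (hσd _ hu) hPpos.ne'
        (Eventually.of_forall hστ)
    rw [hrfun]
    exact (hP _ hu).1.scomp t h1
  have hDn : ∀ t, φ₂ (r t) ≠ 0 → ‖‖P (τ t)‖⁻¹ • P (τ t)‖ = 1 := by
    intro t ht
    have hPpos : 0 < ‖P (τ t)‖ := hm.trans_le (hP _ (hsin t ht)).2.2.2.2.1
    rw [norm_smul, norm_inv, norm_norm, inv_mul_cancel₀ hPpos.ne']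
  have hysign : ∀ t, φ₂ (r t) ≠ 0 → ∃ k > 0, φ₂ (‖P (τ t)‖⁻¹ • P (τ t)) = G (τ t) e₁ * k := by
    intro t ht
    have hu := hsin t ht
    obtain ⟨-, -, hG0, hdet, hPm, -⟩ := hP _ hu
    have hPpos : 0 < ‖P (τ t)‖ := hm.trans_le hPm
    refine ⟨‖P (τ t)‖⁻¹ * (φ₁ (p (τ t)) * φ₂ (P (τ t)) - φ₂ (p (τ t)) * φ₁ (P (τ t))),
      by positivity, ?_⟩
    have hgp := hGp (τ t)
    rw [hw (p (τ t)), map_add, map_smul, map_smul, smul_eq_mul, smul_eq_mul] at hgp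
    rw [hw (P (τ t)), map_add, map_smul, map_smul, smul_eq_mul, smul_eq_mul] at hG0
    rw [map_smul, smul_eq_mul]
    linear_combination (-‖P (τ t)‖⁻¹ * φ₂ (P (τ t))) * hgp + ‖P (τ t)‖⁻¹ * φ₂ (p (τ t)) * hG0
  have hypos : 0 < φ₂ (‖P (τ s)‖⁻¹ • P (τ s)) := by
    obtain ⟨k, hk, h1⟩ := hysign s hb
    have := np_sign hsc e₁ (r s) (r sb) d hd (hrn s) (hrn sb) he1n heq (G (τ s)) (hG1 _)
      (by rw [hr]; exact hGp _)
    rw [h1]; positivity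
  have hybneg : φ₂ (‖P (τ sb)‖⁻¹ • P (τ sb)) < 0 := by
    obtain ⟨k, hk, h1⟩ := hysign sb hbb
    have := np_sign hsc (-e₁) (r sb) (r s) d hd (hrn sb) (hrn s) (by rw [norm_neg, he1n])
      (by rw [smul_neg, ← heq]; abel) (G (τ sb)) (hG1 _)
      (by rw [hr]; exact hGp _)
    rw [map_neg] at this
    rw [h1]; nlinarith
  -- one-sided derivatives at zero
  have hdp' : dp = j • e₁ + (1 + jhat) • e₂ := by
    rw [hr0, ← he₂] at hjj
    have h1 : dp = e₂ + (1/2 : ℝ) • (dp - dm) := by rw [he₂]; module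
    rw [hjj] at h1
    rw [h1]; module
  have hdm' : dm = (-j) • e₁ + (1 - jhat) • e₂ := by
    rw [hr0, ← he₂] at hjj
    have h1 : dm = e₂ - (1/2 : ℝ) • (dp - dm) := by rw [he₂]; module
    rw [hjj] at h1
    rw [h1]; module
  obtain ⟨c, hc, hcev⟩ : ∃ c > 0, ∀ᶠ h in 𝓝[≠] (0:ℝ), c ≤ φ₂ (r h) / h := by
    set M := ‖e₁‖ + ‖e₂‖ with hM
    have hMpos : 0 < M := by rw [hM, he1n]; positivity
    have hEM : ∀ t, ‖Real.cos t • e₁ + Real.sin t • e₂‖ ≤ M := by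
      intro t
      refine (norm_add_le _ _).trans (add_le_add ?_ ?_)
      · rw [norm_smul]
        exact mul_le_of_le_one_left (norm_nonneg _) (Real.abs_cos_le_one t)
      · rw [norm_smul]
        exact mul_le_of_le_one_left (norm_nonneg _) (Real.abs_sin_le_one t)
    refine ⟨M⁻¹ * (2 / Real.pi * C⁻¹), by positivity, ?_⟩
    have hτev : ∀ᶠ h in 𝓝[≠] (0:ℝ), |τ h| < Real.pi / 2 := by
      have h1 : Tendsto (fun h => |τ h|) (𝓝 0) (𝓝 0) := by
        have := (hτ_cont.tendsto 0).abs
        simpa [hτ0] using this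
      exact (h1.eventually (gt_mem_nhds (by positivity))).filter_mono nhdsWithin_le_nhds
    filter_upwards [hτev, eventually_mem_nhdsWithin] with h hh hne0
    have hMi : M⁻¹ ≤ ‖Real.cos (τ h) • e₁ + Real.sin (τ h) • e₂‖⁻¹ :=
      inv_anti₀ (hN _) (hEM _)
    rw [hφ2r, mul_div_assoc]
    refine mul_le_mul hMi ?_ (by positivity) (by positivity)
    rw [abs_lt] at hh
    rcases lt_or_gt_of_ne (show h ≠ 0 from hne0) with hneg | hpos
    · have hτneg : τ h < 0 := by rw [← hτ0]; exact hτ_mono hneg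
      have h1 := (hσb (τ h) 0 hτneg.le).2
      rw [hσ0, hστ] at h1
      have h2 := Real.mul_le_sin (x := -τ h) (by linarith) (by linarith)
      rw [Real.sin_neg] at h2
      rw [le_div_iff_of_neg hneg]
      have h3 : C⁻¹ * (-h) ≤ -τ h := by
        rw [inv_mul_le_iff₀ hC]; linarith
      have h4 := mul_le_mul_of_nonneg_left h3 (show 0 ≤ 2 / Real.pi by positivity)
      linarith
    · have hτpos : 0 < τ h := by rw [← hτ0]; exact hτ_mono hpos
      have h1 := (hσb 0 (τ h) hτpos.le).2
      rw [hσ0, hστ] at h1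
      have h2 := Real.mul_le_sin (x := τ h) (by linarith) (by linarith)
      rw [le_div_iff₀ hpos]
      have h3 : C⁻¹ * h ≤ τ h := by
        rw [inv_mul_le_iff₀ hC]; linarith
      have h4 := mul_le_mul_of_nonneg_left h3 (show 0 ≤ 2 / Real.pi by positivity)
      linarith
  have hφr0 : φ₂ (r 0) = 0 := by rw [hr0, h21]
  have hjp : 0 < 1 + jhat := by
    have : (𝓝[Ici (0:ℝ) \ {0}] (0:ℝ)).NeBot := by rw [Ici_sdiff_left]; infer_instance
    have := np_side_pos r φ₂ dp (Ici 0) hdp hφr0 c hcev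
    rw [hdp'] at this
    simp only [map_add, map_smul, h21, h22, smul_eq_mul, mul_zero, mul_one, zero_add] at this
    linarith
  have hjm : 0 < 1 - jhat := by
    have : (𝓝[Iic (0:ℝ) \ {0}] (0:ℝ)).NeBot := by rw [Iic_sdiff_right]; infer_instance
    have := np_side_pos r φ₂ dm (Iic 0) hdm hφr0 c hcev
    rw [hdm'] at this
    simp only [map_add, map_smul, h21, h22, smul_eq_mul, mul_zero, mul_one, zero_add] at this
    linarith
  refine ⟨_, _, hrd s hb, hrd sb hbb, ?_, ?_⟩
  · -- existence and uniqueness, with `η` the half-perimeter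
    have hηpos : 0 < η := by
      have := hη 0
      have h2 := hσmono (show (0:ℝ) < 0 + Real.pi by rw [zero_add]; exact Real.pi_pos)
      linarith
    have hτadd : ∀ x, τ (x + η) = τ x + Real.pi := by
      intro x
      apply hσmono.injective
      rw [hστ, hη, hστ]
    have hτsub : ∀ x, τ (x - η) = τ x - Real.pi := by
      intro x
      have := hτadd (x - η)
      rw [sub_add_cancel] at this
      linarith
    have hτrange : ∀ x ε, |ε| < η → |τ (x + ε) - τ x| < Real.pi := by
      intro x ε h
      rw [abs_lt] at h ⊢
      have h1 := hτ_mono (show x + ε < x + η by linarith)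
      have h2 := hτ_mono (show x - η < x + ε by linarith)
      rw [hτadd] at h1
      rw [hτsub] at h2
      constructor <;> linarith
    have hnsph : ∀ t, r t ∈ sphere (0 : X) 1 := fun t => by simp [hrn]
    refine ⟨η, hηpos, fun ε hε0 hε => ?_⟩
    have hset := hbar (r (s + ε)) (hnsph _)
    have hbmem : bar (r (s + ε)) ∈ sphere (0 : X) 1 ∩ {w : X | ∃ t : ℝ, w = r (s + ε) + t • e₁} := by
      rw [← hset]; simp
    obtain ⟨hbs, t0, ht0⟩ := hbmem
    have hbn : ‖bar (r (s + ε))‖ = 1 := by simpa using hbs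
    have hbne : bar (r (s + ε)) ≠ - r sb := by
      intro hcon
      have hmem : - r s ∈ sphere (0 : X) 1 ∩ {w : X | ∃ t : ℝ, w = r (s + ε) + t • e₁} := by
        refine ⟨by simp [hrn], t0 - d, ?_⟩
        rw [sub_smul, ← heq, add_sub, ← ht0, hcon]; abel
      rw [← hset] at hmem
      rcases hmem with h | h
      · have h1 : p (τ (s + ε)) = p (τ s + Real.pi) := by
          rw [hpπ, ← hr, ← hr, h]
        have h2 := abs_lt.mp (hτrange s ε hε)
        have h3 := hinj _ _ h1 (by rw [abs_lt]; constructor <;> linarith [Real.pi_pos])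
        linarith
      · rw [mem_singleton_iff, hcon] at h
        exact hne (by rw [neg_injective h, sub_self])
    obtain ⟨θ, hθ, hpθ⟩ := hsurj _ hbn (τ sb - Real.pi)
    have hθne : θ ≠ τ sb + Real.pi := by
      intro h
      rw [h, hpπ, ← hr] at hpθ
      exact hbne hpθ.symm
    have hθlt : θ < τ sb + Real.pi := by
      refine lt_of_le_of_ne ?_ hθne
      linarith [hθ.2]
    refine ⟨σ θ - sb, ⟨?_, ?_⟩, ?_⟩
    · have h1 := hσmono hθlt
      rw [hη, hστ] at h1
      have h2 := hσmono hθ.1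
      rw [← hτsub, hστ] at h2
      rw [abs_lt]; constructor <;> linarith
    · rw [add_sub_cancel, hr, hτσ, hpθ]
    · rintro εb ⟨hεb, hrεb⟩
      have h1 : p (τ (sb + εb)) = p θ := by rw [← hr, hrεb, hpθ]
      have h2 := abs_lt.mp (hτrange sb εb hεb)
      have h3 := hinj _ _ h1 (by
        rw [abs_lt]; constructor <;> linarith [hθ.1])
      rw [← h3, hστ]; ring
  · intro x y xb yb hx hxb
    have hx1 : φ₁ (‖P (τ s)‖⁻¹ • P (τ s)) = x := by
      rw [hx]; simp [h11, h12]
    have hx2 : φ₂ (‖P (τ s)‖⁻¹ • P (τ s)) = y := by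
      rw [hx]; simp [h21, h22]
    have hxb1 : φ₁ (‖P (τ sb)‖⁻¹ • P (τ sb)) = xb := by
      rw [hxb]; simp [h11, h12]
    have hxb2 : φ₂ (‖P (τ sb)‖⁻¹ • P (τ sb)) = yb := by
      rw [hxb]; simp [h21, h22]
    have hy : 0 < y := hx2 ▸ hypos
    refine ⟨⟨hy, hxb2 ▸ hybneg⟩, ?_, ?_, ?_⟩
    · intro eb heb hev
      have := np_rates r e₁ he1n φ₁ φ₂ h11 h21 _ _ s sb d hd (hrd s hb) (hrd sb hbb) (hDn s hb)
        (hDn sb hbb) hypos hybneg heq eb heb (by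
          filter_upwards [hev] with ε hε
          have hbmem : bar (r (s + ε)) ∈
              sphere (0 : X) 1 ∩ {w : X | ∃ t : ℝ, w = r (s + ε) + t • e₁} := by
            rw [← hbar (r (s + ε)) (by simp [hrn])]; simp
          obtain ⟨-, t, ht⟩ := hbmem
          refine ⟨-t, ?_⟩
          rw [hε, ht, neg_smul]; abel)
      rw [hx1, hx2, hxb1, hxb2] at this
      exact this
    · have := np_oneside r e₁ dp _ (Ici 0) (mem_Ici.mpr le_rfl)
        (fun k hk t ht => mul_nonneg hk.le ht) hr0 hrn hdp s sb d (x - j * y / (1 + jhat))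
        (y / (1 + jhat)) hd (by positivity) (hrd s hb) (by
          rw [hx, hdp', smul_add, smul_smul, smul_smul, div_mul_cancel₀ _ hjp.ne', ← add_assoc,
            ← add_smul]
          congr 2
          ring) heq
      rwa [Ici_sdiff_left] at this
    · have := np_oneside r e₁ dm _ (Iic 0) (mem_Iic.mpr le_rfl)
        (fun k hk t ht => mul_nonpos_of_nonneg_of_nonpos hk.le ht) hr0 hrn hdm s sb d
        (x + j * y / (1 - jhat))
        (y / (1 - jhat)) hd (by positivity) (hrd s hb) (by
          rw [hx, hdm', smul_add, smul_smul, smul_smul, div_mul_cancel₀ _ hjm.ne', ← add_assoc,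
            ← add_smul]
          congr 2
          ring) heq
      rwa [Iic_sdiff_right] at this
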